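/- Let A and B be abelian categories, with A having enough injectives, let F : A → B be an additive left exact functor, and let N ≥ 0 be an integer such that the right derived functors R^iF vanish on every object of A for all i > N. Let E_n → ⋯ → E_1 → E_0 →^{d_0} J → 0 be a complex in A (each consecutive composite is zero) with d_0 an epimorphism, and suppose that for every 0 ≤ j ≤ n the homology object H_j = ker(d_j)/im(d_{j+1}) (where d_{n+1} = 0) satisfies R^iF(H_j) = 0 for all i ≥ 2. Then for every i ≥ 1, if R^iF(J) ≠ 0, there exists an index j with 0 ≤ j ≤ n and i + j ≤ N such that R^{i+j}F(E_j) ≠ 0. -/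

import Mathlib

open CategoryTheory CategoryTheory.Limits

section InjectiveSequences

variable {A : Type*} [Category A] [Abelian A]

/-- The augmentation `X ⟶ I⁰` of an injective resolution of `X`. -/
noncomputable def injectiveAugmentation {X : A} (R : InjectiveResolution X) :
    X ⟶ R.cocomplex.X 0 := R.ι.f 0

instance {X : A} (R : InjectiveResolution X) : Mono (injectiveAugmentation R) :=
  inferInstanceAs (Mono (R.ι.f 0))

@[simp]
lemma injectiveAugmentation_d {X : A} (R : InjectiveResolution X) :
    injectiveAugmentation R ≫ R.cocomplex.d 0 1 = 0 :=
  R.ι_f_zero_comp_complex_d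

lemma exact_injectiveAugmentation {X : A} (R : InjectiveResolution X) :
    (ShortComplex.mk _ _ (injectiveAugmentation_d R)).Exact :=
  ShortComplex.exact_of_f_is_kernel _ R.isLimitKernelFork

/-- The cochain complex `0 ⟶ I ⟶ R⁰ ⟶ R¹ ⟶ ⋯` obtained from a morphism `g : I ⟶ Q` and an
injective resolution `R` of `Q`. -/
noncomputable def splicedCocomplex {I Q : A} (g : I ⟶ Q) (R : InjectiveResolution Q) :
    CochainComplex A ℕ :=
  R.cocomplex.augment (g ≫ injectiveAugmentation R) (by simp)

/-- If `0 ⟶ X ⟶ I ⟶ Q ⟶ 0` is short exact with `I` injective, then an injective resolution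
of `Q` gives an injective resolution of `X`. -/
noncomputable def injectiveResolutionOfShortExact {S : ShortComplex A} (hS : S.ShortExact)
    [hI : Injective S.X₂] (R : InjectiveResolution S.X₃) : InjectiveResolution S.X₁ where
  cocomplex := splicedCocomplex S.g R
  injective
    | 0 => hI
    | k + 1 => R.injective k
  ι := (CochainComplex.fromSingle₀Equiv _ _).symm ⟨S.f, by
    change S.f ≫ S.g ≫ injectiveAugmentation R = 0
    simp⟩
  quasiIso := by
    have := hS.mono_f
    have hg := hS.epi_g
    have w : S.f ≫ S.g ≫ injectiveAugmentation R = 0 := by simp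
    have w' : (S.g ≫ injectiveAugmentation R) ≫ R.cocomplex.d 0 1 = 0 := by simp
    refine ⟨fun k => ?_⟩
    match k with
    | 0 =>
      rw [CochainComplex.quasiIsoAt₀_iff, ShortComplex.quasiIso_iff_of_zeros]
      · suffices h : (ShortComplex.mk S.f (S.g ≫ injectiveAugmentation R) w).Exact by
          refine (ShortComplex.exact_and_mono_f_iff_of_iso ?_).2 ⟨h, inferInstanceAs (Mono S.f)⟩
          refine ShortComplex.isoMk (Iso.refl _) (Iso.refl _) (Iso.refl _) ?_
            ((Category.id_comp _).trans (Category.comp_id _).symm)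
          refine (Category.id_comp _).trans (Eq.trans ?_ (Category.comp_id _).symm)
          exact (CochainComplex.fromSingle₀Equiv_symm_apply_f_zero (C := splicedCocomplex S.g R)
            S.f w).symm
        let φ : S ⟶ ShortComplex.mk S.f (S.g ≫ injectiveAugmentation R) w :=
          { τ₁ := 𝟙 _, τ₂ := 𝟙 _, τ₃ := injectiveAugmentation R }
        have : Epi φ.τ₁ := inferInstanceAs (Epi (𝟙 _))
        have : IsIso φ.τ₂ := inferInstanceAs (IsIso (𝟙 _))
        have : Mono φ.τ₃ := inferInstanceAs (Mono (injectiveAugmentation R))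
        exact (ShortComplex.exact_iff_of_epi_of_isIso_of_mono φ).1 hS.exact
      all_goals rfl
    | 1 =>
      rw [quasiIsoAt_iff_exactAt _ _ (CochainComplex.exactAt_succ_single_obj _ _),
        HomologicalComplex.exactAt_iff' _ 0 1 2 (by simp) (by simp)]
      change (ShortComplex.mk _ _ w').Exact
      let φ : ShortComplex.mk _ _ w' ⟶ ShortComplex.mk _ _ (injectiveAugmentation_d R) :=
        { τ₁ := S.g, τ₂ := 𝟙 _, τ₃ := 𝟙 _ }
      have : Epi φ.τ₁ := hg
      have : IsIso φ.τ₂ := inferInstanceAs (IsIso (𝟙 _))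
      have : Mono φ.τ₃ := inferInstanceAs (Mono (𝟙 _))
      exact (ShortComplex.exact_iff_of_epi_of_isIso_of_mono φ).2 (exact_injectiveAugmentation R)
    | k + 2 =>
      rw [quasiIsoAt_iff_exactAt _ _ (CochainComplex.exactAt_succ_single_obj _ _),
        HomologicalComplex.exactAt_iff' _ (k + 1) (k + 2) (k + 3) (by simp) (by simp)]
      exact R.exact_succ k

/-- A short exact sequence `0 ⟶ X ⟶ Y ⟶ Z ⟶ 0` and a monomorphism `Y ⟶ I` into an injective
object give a short exact sequence `0 ⟶ Z ⟶ I / X ⟶ I / Y ⟶ 0`. -/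
lemma exists_injective_rotation [EnoughInjectives A] {S : ShortComplex A} (hS : S.ShortExact) :
    ∃ (I Q₁ Q₂ : A) (_ : Injective I) (ι : S.X₂ ⟶ I) (p : I ⟶ Q₁) (u : S.X₃ ⟶ Q₁) (v : Q₁ ⟶ Q₂)
      (w₁ : (S.f ≫ ι) ≫ p = 0) (w₂ : ι ≫ p ≫ v = 0) (w₃ : u ≫ v = 0),
      (ShortComplex.mk _ _ w₁).ShortExact ∧ (ShortComplex.mk _ _ w₂).ShortExact ∧
      (ShortComplex.mk _ _ w₃).ShortExact ∧ IsPullback ι S.g p u := by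
  have := hS.mono_f
  have := hS.epi_g
  let ι : S.X₂ ⟶ Injective.under S.X₂ := Injective.ι S.X₂
  let p := cokernel.π (S.f ≫ ι)
  let q := cokernel.π ι
  have hp : (ShortComplex.mk (S.f ≫ ι) p (cokernel.condition _)).Exact :=
    ShortComplex.exact_cokernel _
  have hq : (ShortComplex.mk ι q (cokernel.condition _)).Exact := ShortComplex.exact_cokernel _
  have hιq : ι ≫ q = 0 := cokernel.condition _
  obtain ⟨u, hu⟩ := hS.exact.desc' (ι ≫ p) (by
    rw [← Category.assoc]; exact cokernel.condition _)
  obtain ⟨v, hv⟩ := hp.desc' q (by simp [hιq])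
  dsimp only at hv v
  have w₂ : ι ≫ p ≫ v = 0 := by rw [hv, hιq]
  have w₃ : u ≫ v = 0 := by
    rw [← cancel_epi S.g, reassoc_of% hu, w₂, comp_zero]
  have hSι : (ShortComplex.mk ι (p ≫ v) w₂).ShortExact := by
    have : Epi (p ≫ v) := by rw [hv]; infer_instance
    refine { exact := ?_, mono_f := inferInstanceAs (Mono ι), epi_g := this }
    convert hq
  have hmono : Mono u := by
    refine Preadditive.mono_of_cancel_zero _ fun {T} z hz => ?_
    obtain ⟨T', π, _, y, hy⟩ := surjective_up_to_refinements_of_epi S.g z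
    obtain ⟨T'', π', _, x, hx⟩ := hp.exact_up_to_refinements (y ≫ ι) (by
      dsimp only
      rw [Category.assoc, ← hu, ← reassoc_of% hy, hz, comp_zero])
    dsimp only at hx x
    have hx' : π' ≫ y = x ≫ S.f := by
      rw [← cancel_mono ι]; simpa using hx
    rw [← cancel_epi π, ← cancel_epi π', hy, reassoc_of% hx', S.zero]
    simp
  have hepi : Epi v := by
    have : Epi (p ≫ v) := by rw [hv]; infer_instance
    exact epi_of_epi p v
  refine ⟨_, _, _, inferInstance, ι, p, u, v, cokernel.condition _, w₂, w₃,
    { exact := hp, mono_f := mono_comp S.f ι, epi_g := inferInstanceAs (Epi p) }, hSι,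
    { exact := ?_, mono_f := hmono, epi_g := hepi }, ⟨⟨hu.symm⟩, ⟨?_⟩⟩⟩
  · rw [ShortComplex.exact_iff_exact_up_to_refinements]
    intro T z hz
    dsimp only at z hz
    obtain ⟨T', π, _, y, hy⟩ := surjective_up_to_refinements_of_epi p z
    obtain ⟨T'', π', _, x, hx⟩ := hSι.exact.exact_up_to_refinements y (by
      dsimp only; rw [← reassoc_of% hy, hz, comp_zero])
    dsimp only at hx x
    refine ⟨T'', π' ≫ π, inferInstance, x ≫ S.g, ?_⟩
    dsimp only
    rw [Category.assoc, Category.assoc, hu, hy, reassoc_of% hx]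
  · refine PullbackCone.IsLimit.mk _
      (fun s => hSι.exact.lift s.fst (by
        dsimp only; rw [s.condition_assoc, w₃, comp_zero])) ?_ ?_ ?_
    · intro s
      exact hSι.exact.lift_f _ _
    · intro s
      rw [← cancel_mono u, Category.assoc, hu, ← s.condition, ← Category.assoc]
      congr 1
      exact hSι.exact.lift_f _ _
    · intro s m h₁ h₂
      rw [← cancel_mono ι, h₁]
      exact (hSι.exact.lift_f _ _).symm

end InjectiveSequences

section RightDerivedVanishing

variable {A B : Type*} [Category A] [Category B] [Abelian A] [Abelian B] [EnoughInjectives A]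
  (F : A ⥤ B) [F.Additive]

lemma isZero_rightDerived_succ_iff {X : A} (R : InjectiveResolution X) (k : ℕ) :
    IsZero ((F.rightDerived (k + 1)).obj X) ↔
      (((F.mapHomologicalComplex _).obj R.cocomplex).sc' k (k + 1) (k + 2)).Exact := by
  rw [(R.isoRightDerivedObj F (k + 1)).isZero_iff,
    ← HomologicalComplex.exactAt_iff' _ k (k + 1) (k + 2) (by simp) (by simp),
    HomologicalComplex.exactAt_iff_isZero_homology]
  rfl

lemma isZero_rightDerived_obj_of_isZero {X : A} (hX : IsZero X) (k : ℕ) :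
    IsZero ((F.rightDerived (k + 1)).obj X) :=
  have := hX.injective
  F.isZero_rightDerived_obj_injective_succ k X

lemma isZero_rightDerived_add_two_iff {S : ShortComplex A} (hS : S.ShortExact)
    [Injective S.X₂] (k : ℕ) :
    IsZero ((F.rightDerived (k + 2)).obj S.X₁) ↔ IsZero ((F.rightDerived (k + 1)).obj S.X₃) := by
  let R := InjectiveResolution.of S.X₃
  rw [isZero_rightDerived_succ_iff F (injectiveResolutionOfShortExact hS R) (k + 1),
    isZero_rightDerived_succ_iff F R k]
  rfl

variable [PreservesFiniteLimits F]

omit [EnoughInjectives A] in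
lemma exact_map_of_shortExact {S : ShortComplex A} (hS : S.ShortExact) : (S.map F).Exact :=
  hS.exact.map_of_mono_of_preservesKernel F hS.mono_f inferInstance

lemma isZero_rightDerived_one_iff {S : ShortComplex A} (hS : S.ShortExact) [Injective S.X₂] :
    IsZero ((F.rightDerived 1).obj S.X₁) ↔ Epi (F.map S.g) := by
  let R := InjectiveResolution.of S.X₃
  rw [isZero_rightDerived_succ_iff F (injectiveResolutionOfShortExact hS R) 0]
  let ε := injectiveAugmentation R
  have hFR := (exact_injectiveAugmentation R).map_of_mono_of_preservesKernel F
    (inferInstanceAs (Mono ε)) inferInstance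
  have hε : F.map ε ≫ F.map (R.cocomplex.d 0 1) = 0 := by
    rw [← F.map_comp, injectiveAugmentation_d, F.map_zero]
  have w : F.map (S.g ≫ ε) ≫ F.map (R.cocomplex.d 0 1) = 0 := by
    rw [F.map_comp, Category.assoc, hε, comp_zero]
  change (ShortComplex.mk (F.map (S.g ≫ ε)) (F.map (R.cocomplex.d 0 1)) w).Exact ↔ _
  constructor
  · intro h
    rw [epi_iff_surjective_up_to_refinements]
    intro T z
    obtain ⟨T', π, hπ, y, hy⟩ := h.exact_up_to_refinements (z ≫ F.map ε) (by
      dsimp only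
      rw [Category.assoc, hε, comp_zero])
    refine ⟨T', π, hπ, y, ?_⟩
    rw [← cancel_mono (F.map ε)]
    simpa using hy
  · intro h
    let φ : ShortComplex.mk (F.map (S.g ≫ ε)) (F.map (R.cocomplex.d 0 1)) w ⟶
        (ShortComplex.mk _ _ (injectiveAugmentation_d R)).map F :=
      { τ₁ := F.map S.g, τ₂ := 𝟙 _, τ₃ := 𝟙 _
        comm₁₂ := (F.map_comp _ _).symm.trans (Category.comp_id _).symm
        comm₂₃ := (Category.id_comp _).trans (Category.comp_id _).symm }
    have : Epi φ.τ₁ := h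
    have : IsIso φ.τ₂ := inferInstanceAs (IsIso (𝟙 _))
    have : Mono φ.τ₃ := inferInstanceAs (Mono (𝟙 _))
    exact (ShortComplex.exact_iff_of_epi_of_isIso_of_mono φ).2 hFR

lemma epi_map_of_isZero_rightDerived_one {S : ShortComplex A} (hS : S.ShortExact)
    (h : IsZero ((F.rightDerived 1).obj S.X₁)) : Epi (F.map S.g) := by
  obtain ⟨I, Q₁, Q₂, _, ι, p, u, v, w₁, w₂, w₃, h₁, h₂, h₃, sq⟩ := exists_injective_rotation hS
  have : Injective (ShortComplex.mk _ _ w₁).X₂ := by assumption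
  have : Epi (F.map p) := (isZero_rightDerived_one_iff F h₁).1 h
  exact Abelian.epi_snd_of_isLimit _ _ (sq.map F).isLimit

lemma isZero_rightDerived_one_left {S : ShortComplex A} (hS : S.ShortExact)
    (h : Epi (F.map S.g)) (hY : IsZero ((F.rightDerived 1).obj S.X₂)) :
    IsZero ((F.rightDerived 1).obj S.X₁) := by
  obtain ⟨I, Q₁, Q₂, _, ι, p, u, v, w₁, w₂, w₃, h₁, h₂, h₃, sq⟩ := exists_injective_rotation hS
  have : Injective (ShortComplex.mk _ _ w₁).X₂ := by assumption
  have : Injective (ShortComplex.mk _ _ w₂).X₂ := by assumption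
  rw [isZero_rightDerived_one_iff F h₁]
  have hpv : Epi (F.map (p ≫ v)) := (isZero_rightDerived_one_iff F h₂).1 hY
  have hv : Epi (F.map v) := by
    rw [F.map_comp] at hpv
    exact epi_of_epi (F.map p) (F.map v)
  let φ : (ShortComplex.mk _ _ w₂).map F ⟶ (ShortComplex.mk _ _ w₃).map F :=
    { τ₁ := F.map S.g
      τ₂ := F.map p
      τ₃ := 𝟙 _
      comm₁₂ := (sq.map F).w.symm
      comm₂₃ := (F.map_comp _ _).symm.trans (Category.comp_id _).symm }
  have : Epi ((ShortComplex.mk _ _ w₂).map F).g := hpv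
  have : Epi ((ShortComplex.mk _ _ w₃).map F).g := hv
  have : Epi φ.τ₁ := h
  have : Epi φ.τ₃ := inferInstanceAs (Epi (𝟙 _))
  exact ShortComplex.epi_τ₂_of_exact_of_epi φ (exact_map_of_shortExact F h₃)

/-- Consequences of the long exact sequence of right derived functors attached to a short exact
sequence `0 ⟶ X ⟶ Y ⟶ Z ⟶ 0`: vanishing for the middle, the right and the left term. -/
lemma isZero_rightDerived_of_shortExact (k : ℕ) :
    (∀ {S : ShortComplex A}, S.ShortExact → IsZero ((F.rightDerived (k + 1)).obj S.X₁) →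
      IsZero ((F.rightDerived (k + 1)).obj S.X₃) → IsZero ((F.rightDerived (k + 1)).obj S.X₂)) ∧
    (∀ {S : ShortComplex A}, S.ShortExact → IsZero ((F.rightDerived (k + 1)).obj S.X₂) →
      IsZero ((F.rightDerived (k + 2)).obj S.X₁) → IsZero ((F.rightDerived (k + 1)).obj S.X₃)) ∧
    (∀ {S : ShortComplex A}, S.ShortExact → IsZero ((F.rightDerived (k + 1)).obj S.X₃) →
      IsZero ((F.rightDerived (k + 2)).obj S.X₂) →
        IsZero ((F.rightDerived (k + 2)).obj S.X₁)) := by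
  have left_of_middle (k : ℕ)
      (h : ∀ {S : ShortComplex A}, S.ShortExact → IsZero ((F.rightDerived (k + 1)).obj S.X₁) →
        IsZero ((F.rightDerived (k + 1)).obj S.X₃) → IsZero ((F.rightDerived (k + 1)).obj S.X₂))
      {S : ShortComplex A} (hS : S.ShortExact) (hZ : IsZero ((F.rightDerived (k + 1)).obj S.X₃))
      (hY : IsZero ((F.rightDerived (k + 2)).obj S.X₂)) :
      IsZero ((F.rightDerived (k + 2)).obj S.X₁) := by
    obtain ⟨I, Q₁, Q₂, hI, ι, p, u, v, w₁, w₂, w₃, h₁, h₂, h₃, -⟩ := exists_injective_rotation hS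
    have : Injective (ShortComplex.mk _ _ w₁).X₂ := hI
    have : Injective (ShortComplex.mk _ _ w₂).X₂ := hI
    exact (isZero_rightDerived_add_two_iff F h₁ k).2
      (h h₃ hZ ((isZero_rightDerived_add_two_iff F h₂ k).1 hY))
  induction k with
  | zero =>
    have middle {S : ShortComplex A} (hS : S.ShortExact)
        (hX : IsZero ((F.rightDerived 1).obj S.X₁)) (hZ : IsZero ((F.rightDerived 1).obj S.X₃)) :
        IsZero ((F.rightDerived 1).obj S.X₂) := by
      obtain ⟨I, Q₁, Q₂, hI, ι, p, u, v, w₁, w₂, w₃, h₁, h₂, h₃, -⟩ :=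
        exists_injective_rotation hS
      have : Injective (ShortComplex.mk _ _ w₁).X₂ := hI
      have : Injective (ShortComplex.mk _ _ w₂).X₂ := hI
      have hp : Epi (F.map p) := (isZero_rightDerived_one_iff F h₁).1 hX
      have hv : Epi (F.map v) := epi_map_of_isZero_rightDerived_one F h₃ hZ
      refine (isZero_rightDerived_one_iff F h₂).2 ?_
      dsimp only
      rw [F.map_comp]
      exact epi_comp _ _
    refine ⟨middle, fun {S} hS hY hX => ?_, left_of_middle 0 middle⟩
    obtain ⟨I, Q₁, Q₂, hI, ι, p, u, v, w₁, w₂, w₃, h₁, h₂, h₃, -⟩ := exists_injective_rotation hS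
    have : Injective (ShortComplex.mk _ _ w₁).X₂ := hI
    have : Injective (ShortComplex.mk _ _ w₂).X₂ := hI
    have hpv : Epi (F.map (p ≫ v)) := (isZero_rightDerived_one_iff F h₂).1 hY
    rw [F.map_comp] at hpv
    exact isZero_rightDerived_one_left F h₃ (epi_of_epi (F.map p) (F.map v))
      ((isZero_rightDerived_add_two_iff F h₁ 0).1 hX)
  | succ k ih =>
    obtain ⟨-, ih_right, ih_left⟩ := ih
    have middle {S : ShortComplex A} (hS : S.ShortExact)
        (hX : IsZero ((F.rightDerived (k + 2)).obj S.X₁))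
        (hZ : IsZero ((F.rightDerived (k + 2)).obj S.X₃)) :
        IsZero ((F.rightDerived (k + 2)).obj S.X₂) := by
      obtain ⟨I, Q₁, Q₂, hI, ι, p, u, v, w₁, w₂, w₃, h₁, h₂, h₃, -⟩ :=
        exists_injective_rotation hS
      have : Injective (ShortComplex.mk _ _ w₁).X₂ := hI
      have : Injective (ShortComplex.mk _ _ w₂).X₂ := hI
      have hQ₂ := ih_right h₃ ((isZero_rightDerived_add_two_iff F h₁ k).1 hX) hZ
      exact (isZero_rightDerived_add_two_iff F h₂ k).2 hQ₂
    refine ⟨middle, fun {S} hS hY hX => ?_, left_of_middle (k + 1) middle⟩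
    obtain ⟨I, Q₁, Q₂, hI, ι, p, u, v, w₁, w₂, w₃, h₁, h₂, h₃, -⟩ := exists_injective_rotation hS
    have : Injective (ShortComplex.mk _ _ w₁).X₂ := hI
    have : Injective (ShortComplex.mk _ _ w₂).X₂ := hI
    exact ih_left h₃ ((isZero_rightDerived_add_two_iff F h₂ k).1 hY)
      ((isZero_rightDerived_add_two_iff F h₁ (k + 1)).1 hX)

end RightDerivedVanishing

section Boundaries

variable {A : Type*} [Category A] [Abelian A] (K : ChainComplex A ℕ)

lemma shortExact_cycles_of_factorisation {j : ℕ} {B : A} (p : K.X (j + 1) ⟶ B) (m : B ⟶ K.X j)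
    [Epi p] [Mono m] (h : p ≫ m = K.d (j + 1) j) (w : K.iCycles (j + 1) ≫ p = 0) :
    (ShortComplex.mk (K.iCycles (j + 1)) p w).ShortExact where
  exact := by
    rw [ShortComplex.exact_iff_exact_up_to_refinements]
    intro T z hz
    dsimp only at z hz
    have hz' : z ≫ K.d (j + 1) j = 0 := by rw [← h, reassoc_of% hz, zero_comp]
    exact ⟨T, 𝟙 T, inferInstance, K.liftCycles z j (by simp) hz', by simp⟩
  mono_f := inferInstanceAs (Mono (K.iCycles (j + 1)))
  epi_g := inferInstanceAs (Epi p)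

lemma shortExact_boundaries (j : ℕ) :
    (ShortComplex.mk (kernel.ι (K.homologyπ j)) (K.homologyπ j)
      (kernel.condition _)).ShortExact where
  exact := ShortComplex.exact_kernel _
  mono_f := inferInstanceAs (Mono (kernel.ι _))
  epi_g := inferInstanceAs (Epi (K.homologyπ j))

lemma exists_shortExact_cycles_boundaries (j : ℕ) :
    ∃ (p : K.X (j + 1) ⟶ kernel (K.homologyπ j)) (w : K.iCycles (j + 1) ≫ p = 0),
      (ShortComplex.mk (K.iCycles (j + 1)) p w).ShortExact := by
  let p := kernel.lift (K.homologyπ j) (K.toCycles (j + 1) j) (by simp)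
  have hp : p ≫ kernel.ι _ = K.toCycles (j + 1) j := kernel.lift_ι _ _ _
  let m := kernel.ι (K.homologyπ j) ≫ K.iCycles j
  have hm : p ≫ m = K.d (j + 1) j := by simp [m, reassoc_of% hp]
  have hmono : Mono m := mono_comp _ _
  have hex : (ShortComplex.mk (K.toCycles (j + 1) j) (K.homologyπ j) (by simp)).Exact :=
    ShortComplex.exact_of_g_is_cokernel _ (K.homologyIsCokernel (j + 1) j (by simp))
  have hepi : Epi p := by
    rw [epi_iff_surjective_up_to_refinements]
    intro T z
    obtain ⟨T', π, hπ, y, hy⟩ := hex.exact_up_to_refinements (z ≫ kernel.ι _) (by simp)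
    refine ⟨T', π, hπ, y, ?_⟩
    rw [← cancel_mono (kernel.ι (K.homologyπ j)), Category.assoc, Category.assoc, hp]
    exact hy
  have w : K.iCycles (j + 1) ≫ p = 0 := by
    rw [← cancel_mono m, Category.assoc, hm]; simp
  exact ⟨p, w, shortExact_cycles_of_factorisation K p m hm w⟩

end Boundaries

/-- Let `A` and `B` be abelian categories, with `A` having enough injectives, let
`F : A ⥤ B` be an additive left exact functor, and let `N ≥ 0` be an integer such that
the right derived functors `R^iF` vanish on every object of `A` for all `i > N`.
Let `E_n ⟶ ⋯ ⟶ E_1 ⟶ E_0 ⟶ J ⟶ 0` be a complex in `A` with the last map an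
epimorphism (encoded as a chain complex `Cx` with `Cx.X 0 = J`, `Cx.X (j+1) = E_j`,
and `Cx.X j = 0` for `j > n + 1`, so that `d_{n+1} = 0`), and suppose that for every
`0 ≤ j ≤ n` the homology object `H_j = ker d_j / im d_{j+1}` (the homology of `Cx` in
degree `j + 1`) satisfies `R^iF(H_j) = 0` for all `i ≥ 2`.  Then for every `i ≥ 1`, if
`R^iF(J) ≠ 0`, there exists `0 ≤ j ≤ n` with `i + j ≤ N` and `R^{i+j}F(E_j) ≠ 0`. -/
theorem derived_nonvanishing_of_resolution
    {A B : Type*} [Category A] [Category B] [Abelian A] [Abelian B]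
    [EnoughInjectives A]
    (F : A ⥤ B) [F.Additive] [PreservesFiniteLimits F]
    (N : ℕ)
    (hN : ∀ i : ℕ, N < i → ∀ X : A, IsZero ((F.rightDerived i).obj X))
    (n : ℕ) (Cx : ChainComplex A ℕ)
    (hfinite : ∀ j : ℕ, n + 1 < j → IsZero (Cx.X j))
    (hepi : Epi (Cx.d 1 0))
    (hH : ∀ j : ℕ, j ≤ n → ∀ i : ℕ, 2 ≤ i →
      IsZero ((F.rightDerived i).obj (Cx.homology (j + 1))))
    (i : ℕ) (hi : 1 ≤ i)
    (hJ : ¬ IsZero ((F.rightDerived i).obj (Cx.X 0))) :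
    ∃ j : ℕ, j ≤ n ∧ i + j ≤ N ∧
      ¬ IsZero ((F.rightDerived (i + j)).obj (Cx.X (j + 1))) := by
  by_contra! hE
  have hX (j : ℕ) : IsZero ((F.rightDerived (i + j)).obj (Cx.X (j + 1))) := by
    by_cases hij : i + j ≤ N
    · by_cases hj : j ≤ n
      · exact hE j hj hij
      · obtain ⟨k, hk⟩ : ∃ k, i + j = k + 1 := ⟨i + j - 1, by omega⟩
        rw [hk]
        exact isZero_rightDerived_obj_of_isZero F (hfinite _ (by omega)) k
    · exact hN _ (by omega) _
  have hHom (j : ℕ) : IsZero ((F.rightDerived (i + j + 1)).obj (Cx.homology (j + 1))) := by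
    by_cases hj : j ≤ n
    · exact hH j hj _ (by omega)
    · refine isZero_rightDerived_obj_of_isZero F ?_ _
      exact (HomologicalComplex.exactAt_iff_isZero_homology _ _).1
        (ShortComplex.exact_of_isZero_X₂ _ (hfinite _ (by omega)))
  have hCycles (m : ℕ) : ∀ j : ℕ, N < i + j + 1 + m →
      IsZero ((F.rightDerived (i + j + 1)).obj (Cx.cycles (j + 1))) := by
    induction m with
    | zero => exact fun j hj => hN _ hj _
    | succ m ih =>
      intro j hj
      refine (isZero_rightDerived_of_shortExact F (i + j)).1 (shortExact_boundaries Cx (j + 1))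
        ?_ (hHom j)
      obtain ⟨p, w, h⟩ := exists_shortExact_cycles_boundaries Cx (j + 1)
      exact (isZero_rightDerived_of_shortExact F (i + j)).2.1 h (hX (j + 1))
        (ih (j + 1) (by omega))
  obtain ⟨k, rfl⟩ : ∃ k, i = k + 1 := ⟨i - 1, by omega⟩
  exact hJ ((isZero_rightDerived_of_shortExact F k).2.1
    (shortExact_cycles_of_factorisation Cx (Cx.d 1 0) (𝟙 _) (by simp) (by simp))
    (hX 0) (hCycles N 0 (by omega)))
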